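/- (Property of category conformity, positive flows.) Let r : Fin (k+1) → X be limiting profiles satisfying Condition 2 (g (r h) j ≥ g (r l) j for all criteria j whenever h < l), all pairwise distinct, and let a be an alternative distinct from all profiles. Suppose the performances of a lie between two successive profiles: g (r (h+1)) j ≤ g a j ≤ g (r h) j for every criterion j. Then, over R_a = {r 0, …, r k, a}, the positive Choquet-flows satisfy φ⁺_{R_a}(r h) ≥ φ⁺_{R_a}(a) and φ⁺_{R_a}(a) ≥ φ⁺_{R_a}(r (h+1)). -/

import Mathlib

open Finset

/-- The 2-additive Choquet integral (Möbius form). -/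
noncomputable def CI2 (n : ℕ) (m : Fin n → ℝ) (M : Fin n → Fin n → ℝ)
    (P : Fin n → ℝ) : ℝ :=
  ∑ j, m j * P j + ∑ j, ∑ s, if j < s then M j s * min (P j) (P s) else 0

/-- The Choquet-outranking degree of `x` over `y` built from evaluations `g` and
preference functions `F`. -/
noncomputable def outrank {X : Type*} (n : ℕ) (m : Fin n → ℝ) (M : Fin n → Fin n → ℝ)
    (g : X → Fin n → ℝ) (F : Fin n → ℝ → ℝ) (x y : X) : ℝ :=
  CI2 n m M (fun j => F j (g x j - g y j))

/-- The positive Choquet-flow of `x` within the finite set `S`. -/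
noncomputable def posFlow {X : Type*} [DecidableEq X] (π : X → X → ℝ)
    (S : Finset X) (x : X) : ℝ :=
  (1 / ((S.card : ℝ) - 1)) * ∑ y ∈ S.erase x, π x y

/-- The negative Choquet-flow of `x` within the finite set `S`. -/
noncomputable def negFlow {X : Type*} [DecidableEq X] (π : X → X → ℝ)
    (S : Finset X) (x : X) : ℝ :=
  (1 / ((S.card : ℝ) - 1)) * ∑ y ∈ S.erase x, π y x

/-- The net Choquet-flow of `x` within the finite set `S`. -/
noncomputable def netFlow {X : Type*} [DecidableEq X] (π : X → X → ℝ)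
    (S : Finset X) (x : X) : ℝ :=
  posFlow π S x - negFlow π S x

/-- Monotonicity of the 2-additive Choquet integral. Passing from `P` to `Q` one criterion at a
time, in decreasing order, splits the difference of the integrals into nonnegative parts. -/
theorem CI2_mono {n : ℕ} {m : Fin n → ℝ} {M : Fin n → Fin n → ℝ}
    (hsymm : ∀ j s, M j s = M s j)
    (hmono : ∀ j (S : Finset (Fin n)), j ∉ S → 0 ≤ m j + ∑ s ∈ S, M j s) :
    Monotone (CI2 n m M) := by
  intro P Q hPQ
  let w : Fin n → Fin n → ℝ := fun j s =>
    if j < s then min (Q j) (Q s) - min (P j) (Q s)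
    else if s < j then min (Q j) (P s) - min (P j) (P s) else 0
  have hmin (x : ℝ) (j : Fin n) :
      0 ≤ min (Q j) x - min (P j) x ∧ min (Q j) x - min (P j) x ≤ Q j - P j := by
    have := hPQ j
    rcases min_cases (Q j) x with h | h <;> rcases min_cases (P j) x with h' | h' <;>
      constructor <;> linarith
  have hw (j s : Fin n) : 0 ≤ w j s ∧ w j s ≤ Q j - P j := by
    dsimp only [w]
    split_ifs
    · exact hmin _ j
    · exact hmin _ j
    · exact ⟨le_rfl, sub_nonneg.2 (hPQ j)⟩
  have hww (j : Fin n) : w j j = 0 := by simp [w]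
  have hdiff : CI2 n m M Q - CI2 n m M P =
      ∑ j, (m j * (Q j - P j) + ∑ s, M j s * w j s) := by
    have hsplit : ∑ j, ∑ s, M j s * w j s =
        ∑ j, ∑ s, (if j < s then M j s * w j s else 0) +
          ∑ j, ∑ s, (if j < s then M s j * w s j else 0) := by
      rw [Finset.sum_comm (f := fun j s => if j < s then M s j * w s j else 0)]
      simp only [← Finset.sum_add_distrib]
      refine Finset.sum_congr rfl fun j _ => Finset.sum_congr rfl fun s _ => ?_
      rcases lt_trichotomy j s with h | rfl | h
      · simp [h, h.not_gt]
      · simp [hww]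
      · simp [h, h.not_gt]
    rw [Finset.sum_add_distrib, hsplit]
    simp only [CI2, mul_sub, Finset.sum_sub_distrib]
    rw [add_sub_add_comm]
    congr 1
    simp only [← Finset.sum_sub_distrib, ← Finset.sum_add_distrib]
    refine Finset.sum_congr rfl fun j _ => Finset.sum_congr rfl fun s _ => ?_
    split_ifs with h
    · simp only [w, h, h.not_gt, if_true, if_false]
      rw [hsymm s j, min_comm (Q s) (P j), min_comm (P s) (P j)]
      ring
    · simp
  rw [← sub_nonneg, hdiff]
  refine Finset.sum_nonneg fun j _ => ?_
  let S := Finset.univ.filter fun s => s ≠ j ∧ M j s < 0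
  have hS : j ∉ S := by simp [S]
  have hle : ∑ s ∈ S, M j s * (Q j - P j) ≤ ∑ s, M j s * w j s := by
    rw [Finset.sum_filter]
    refine Finset.sum_le_sum fun s _ => ?_
    split_ifs with h
    · exact mul_le_mul_of_nonpos_left (hw j s).2 h.2.le
    · by_cases hs : s = j
      · simp [hs, hww]
      · exact mul_nonneg (not_lt.1 fun h' => h ⟨hs, h'⟩) (hw j s).1
  rw [← Finset.sum_mul] at hle
  have := mul_nonneg (hmono j S hS) (sub_nonneg.2 (hPQ j))
  linarith

theorem outrank_self {X : Type*} {n : ℕ} (m : Fin n → ℝ) (M : Fin n → Fin n → ℝ)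
    (g : X → Fin n → ℝ) {F : Fin n → ℝ → ℝ} (hF : ∀ j, F j 0 = 0) (x : X) :
    outrank n m M g F x x = 0 := by
  simp [outrank, CI2, hF]

theorem posFlow_le_posFlow {X : Type*} [DecidableEq X] {π : X → X → ℝ} (hπ : ∀ x, π x x = 0)
    (S : Finset X) {x y : X} (hx : x ∈ S) (hxy : ∀ z, π x z ≤ π y z) :
    posFlow π S x ≤ posFlow π S y := by
  have hcard : (1 : ℝ) ≤ S.card := by exact_mod_cast Finset.card_pos.2 ⟨x, hx⟩
  have hsum (z : X) : ∑ t ∈ S.erase z, π z t = ∑ t ∈ S, π z t :=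
    Finset.sum_erase S (hπ z)
  rw [posFlow, posFlow, hsum, hsum]
  exact mul_le_mul_of_nonneg_left (Finset.sum_le_sum fun z _ => hxy z)
    (one_div_nonneg.2 (sub_nonneg.2 hcard))

/-- Property of category conformity, positive flows: if the performances
of `a` lie between two successive limiting profiles, then its positive Choquet-flow lies
between the flows of these profiles. -/
theorem category_conformity_posFlow {X : Type*} [DecidableEq X] (n k : ℕ)
    (m : Fin n → ℝ) (M : Fin n → Fin n → ℝ)
    (hsymm : ∀ j s, M j s = M s j) (hdiag : ∀ j, M j j = 0)
    (hmono1 : ∀ j, 0 ≤ m j)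
    (hmono2 : ∀ j (S : Finset (Fin n)), j ∉ S → 0 ≤ m j + ∑ s ∈ S, M j s)
    (g : X → Fin n → ℝ) (F : Fin n → ℝ → ℝ)
    (hF1 : ∀ j, Monotone (F j))
    (hF2 : ∀ j d, 0 ≤ F j d ∧ F j d ≤ 1)
    (hF3 : ∀ j d, d ≤ 0 → F j d = 0)
    (r : Fin (k + 1) → X)
    (hinj : Function.Injective r)
    (hcond2 : ∀ h l : Fin (k + 1), h < l → ∀ j, g (r l) j ≤ g (r h) j)
    (a : X) (ha : ∀ h, a ≠ r h)
    (h : Fin k)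
    (hsandwich : ∀ j, g (r h.succ) j ≤ g a j ∧ g a j ≤ g (r h.castSucc) j) :
    posFlow (outrank n m M g F) (insert a (Finset.image r Finset.univ)) a
        ≤ posFlow (outrank n m M g F) (insert a (Finset.image r Finset.univ))
          (r h.castSucc) ∧
      posFlow (outrank n m M g F) (insert a (Finset.image r Finset.univ)) (r h.succ)
        ≤ posFlow (outrank n m M g F) (insert a (Finset.image r Finset.univ)) a := by
  have hself := outrank_self m M g fun j => hF3 j 0 le_rfl
  have hmono {x y : X} (hxy : ∀ j, g x j ≤ g y j) (z : X) :
      outrank n m M g F x z ≤ outrank n m M g F y z :=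
    CI2_mono hsymm hmono2 fun j => hF1 j (sub_le_sub_right (hxy j) _)
  exact ⟨posFlow_le_posFlow hself _ (by simp) (hmono fun j => (hsandwich j).2),
    posFlow_le_posFlow hself _ (by simp) (hmono fun j => (hsandwich j).1)⟩
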